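/- Let p be a prime and let φ : T → S be the restriction homomorphism with φ(n) = ∏_{i ∈ ZMod p} x_i and φ(t_v) = O(v). Then the kernel of φ is the principal ideal of T generated by t_{0̄} − p (where 0̄ is the zero exponent vector). -/

import Mathlib

/-!
STATEMENT 5: Let `p` be a prime and let `φ : T → S` be the restriction homomorphism with
`φ(n) = ∏ᵢ xᵢ` and `φ(t_v) = O(v)`.  Then the kernel of `φ` is the principal ideal of `T`
generated by `t_0̄ − p` (where `0̄` is the zero exponent vector).
-/

/-- The shift action of `j : ZMod p` on exponent vectors: `(σʲ v) i = v (i - j)`. -/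
def shiftVec (p : ℕ) (j : ZMod p) (v : ZMod p → ℕ) : ZMod p → ℕ :=
  fun i => v (i - j)

/-- The monomial `x^v = ∏ᵢ xᵢ^{v i}`. -/
noncomputable def expMonomial (p : ℕ) [NeZero p] (v : ZMod p → ℕ) :
    MvPolynomial (ZMod p) ℤ :=
  MvPolynomial.monomial (Finsupp.equivFunOnFinite.symm v) 1

/-- The orbit sum `O(v) = Σ_{j = 0}^{p-1} x^{σʲ v}`. -/
noncomputable def orbitSum (p : ℕ) [NeZero p] (v : ZMod p → ℕ) :
    MvPolynomial (ZMod p) ℤ :=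
  ∑ j : ZMod p, expMonomial p (shiftVec p j v)

/-- Generators of the presented ring `T`: `none` is the generator `n`, and `some v` is the
generator `t_v` for an exponent vector `v : ZMod p → ℕ`. -/
abbrev TGen (p : ℕ) : Type := Option (ZMod p → ℕ)

/-- The ideal of relations defining `T`:
`t_0̄² = p t_0̄`, `t_v = t_{σv}`, `n t_v = t_{v + 1̄}`, and
`t_v t_w = Σ_{j=0}^{p-1} t_{v + σʲ w}`. -/
noncomputable def relIdeal (p : ℕ) [NeZero p] : Ideal (MvPolynomial (TGen p) ℤ) :=
  Ideal.span
    ({MvPolynomial.X (some (0 : ZMod p → ℕ)) ^ 2 -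
        (p : MvPolynomial (TGen p) ℤ) * MvPolynomial.X (some (0 : ZMod p → ℕ))} ∪
      Set.range (fun v : ZMod p → ℕ =>
        MvPolynomial.X (some v) - MvPolynomial.X (some (shiftVec p 1 v))) ∪
      Set.range (fun v : ZMod p → ℕ =>
        MvPolynomial.X none * MvPolynomial.X (some v) - MvPolynomial.X (some (v + 1))) ∪
      Set.range (fun vw : (ZMod p → ℕ) × (ZMod p → ℕ) =>
        MvPolynomial.X (some vw.1) * MvPolynomial.X (some vw.2) -
          ∑ j : ZMod p, MvPolynomial.X (some (vw.1 + shiftVec p j vw.2))))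

/-- The presented commutative ring `T`: the value at the fixed level `C_p/C_p` of the free
`C_p`-Tambara functor on an underlying generator. -/
abbrev TRing (p : ℕ) [NeZero p] : Type := MvPolynomial (TGen p) ℤ ⧸ relIdeal p

/-- The image of `n` in `T`. -/
noncomputable def nElt (p : ℕ) [NeZero p] : TRing p :=
  Ideal.Quotient.mk (relIdeal p) (MvPolynomial.X none)

/-- The image of `t_v` in `T`. -/
noncomputable def tElt (p : ℕ) [NeZero p] (v : ZMod p → ℕ) : TRing p :=
  Ideal.Quotient.mk (relIdeal p) (MvPolynomial.X (some v))


theorem shiftVec_zero (p : ℕ) (v : ZMod p → ℕ) : shiftVec p 0 v = v := by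
  funext i
  simp [shiftVec]

theorem shiftVec_shiftVec (p : ℕ) (j k : ZMod p) (v : ZMod p → ℕ) :
    shiftVec p j (shiftVec p k v) = shiftVec p (j + k) v := by
  funext i
  simp [shiftVec, sub_sub]

/-- A vector fixed by a nontrivial shift is constant, as `p` is prime. -/
theorem eq_const_of_shiftVec_eq_self {p : ℕ} [Fact p.Prime] {d : ZMod p} (hd : d ≠ 0)
    {v : ZMod p → ℕ} (h : shiftVec p d v = v) (i : ZMod p) : v i = v 0 := by
  have hm : ∀ m : ℕ, v (m * d) = v 0 := by
    intro m
    induction m with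
    | zero => simp
    | succ m ih =>
      rw [← ih, ← congrFun h ((m + 1 : ℕ) * d)]
      simp [shiftVec, add_mul]
  have := hm (i / d).val
  rwa [ZMod.natCast_zmod_val, div_mul_cancel₀ _ hd] at this

theorem shiftVec_injective_of_not_const {p : ℕ} [Fact p.Prime] {v : ZMod p → ℕ}
    (hv : ¬ ∀ i, v i = v 0) : Function.Injective fun j => shiftVec p j v := by
  intro j k h
  by_contra hjk
  refine hv (eq_const_of_shiftVec_eq_self (sub_ne_zero.mpr hjk) ?_)
  have h' := congrArg (shiftVec p (-k)) h
  simpa [shiftVec_shiftVec, shiftVec_zero, neg_add_eq_sub] using h'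

/-- The relation of lying in the same cyclic shift orbit. -/
def shiftSetoid (p : ℕ) : Setoid (ZMod p → ℕ) where
  r v w := ∃ j, shiftVec p j v = w
  iseqv :=
    { refl := fun v => ⟨0, shiftVec_zero p v⟩
      symm := by
        rintro v _ ⟨j, rfl⟩
        exact ⟨-j, by rw [shiftVec_shiftVec, neg_add_cancel, shiftVec_zero]⟩
      trans := by
        rintro v _ _ ⟨j, rfl⟩ ⟨k, rfl⟩
        exact ⟨k + j, (shiftVec_shiftVec p k j v).symm⟩ }

/-- A chosen representative of the shift orbit of `v`. -/
noncomputable def orbitRep (p : ℕ) (v : ZMod p → ℕ) : ZMod p → ℕ :=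
  (Quotient.mk (shiftSetoid p) v).out

theorem orbitRep_shiftVec (p : ℕ) (j : ZMod p) (v : ZMod p → ℕ) :
    orbitRep p (shiftVec p j v) = orbitRep p v := by
  have h : Quotient.mk (shiftSetoid p) v = Quotient.mk (shiftSetoid p) (shiftVec p j v) :=
    Quotient.sound ⟨j, rfl⟩
  rw [orbitRep, orbitRep, h]

theorem exists_shiftVec_eq_orbitRep (p : ℕ) (v : ZMod p → ℕ) :
    ∃ j, shiftVec p j v = orbitRep p v :=
  (shiftSetoid p).symm (Quotient.mk_out (s := shiftSetoid p) v)

section Relations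

variable (p : ℕ) [NeZero p]

theorem tElt_shiftVec_one (v : ZMod p → ℕ) : tElt p (shiftVec p 1 v) = tElt p v := by
  symm
  exact Ideal.Quotient.eq.mpr (Ideal.subset_span (Or.inl (Or.inl (Or.inr ⟨v, rfl⟩))))

theorem tElt_shiftVec (j : ZMod p) (v : ZMod p → ℕ) : tElt p (shiftVec p j v) = tElt p v := by
  have hm : ∀ m : ℕ, tElt p (shiftVec p m v) = tElt p v := by
    intro m
    induction m with
    | zero => simp [shiftVec_zero]
    | succ m ih => rw [← ih, ← tElt_shiftVec_one p (shiftVec p m v), shiftVec_shiftVec,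
        Nat.cast_succ, add_comm]
  simpa using hm j.val

theorem nElt_mul_tElt (v : ZMod p → ℕ) : nElt p * tElt p v = tElt p (v + 1) := by
  rw [nElt, tElt, tElt, ← map_mul]
  exact Ideal.Quotient.eq.mpr
    (Ideal.subset_span (Or.inl (Or.inr ⟨v, rfl⟩)))

theorem tElt_mul_tElt (v w : ZMod p → ℕ) :
    tElt p v * tElt p w = ∑ j : ZMod p, tElt p (v + shiftVec p j w) := by
  simp only [tElt]
  rw [← map_mul, ← map_sum]
  exact Ideal.Quotient.eq.mpr
    (Ideal.subset_span (Or.inr ⟨(v, w), rfl⟩))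

theorem nElt_pow_mul_tElt (k : ℕ) (v : ZMod p → ℕ) :
    nElt p ^ k * tElt p v = tElt p (v + fun _ => k) := by
  induction k with
  | zero => rw [pow_zero, one_mul]; rfl
  | succ k ih => rw [pow_succ', mul_assoc, ih, nElt_mul_tElt]; rfl

/-- The powers of `n` and the `t_v` generate the ring `T` additively. -/
theorem closure_nElt_pow_union_tElt :
    AddSubgroup.closure
      (Set.range (fun k : ℕ => nElt p ^ k) ∪ Set.range (tElt p)) = ⊤ := by
  set A := AddSubgroup.closure
    (Set.range (fun k : ℕ => nElt p ^ k) ∪ Set.range (tElt p))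
  have hn : ∀ k : ℕ, nElt p ^ k ∈ A := fun k => AddSubgroup.subset_closure (Or.inl ⟨k, rfl⟩)
  have ht : ∀ v, tElt p v ∈ A := fun v => AddSubgroup.subset_closure (Or.inr ⟨v, rfl⟩)
  have hmul : ∀ g : TGen p, ∀ x ∈ A,
      x * Ideal.Quotient.mk (relIdeal p) (MvPolynomial.X g) ∈ A := by
    intro g x hx
    induction hx using AddSubgroup.closure_induction with
    | zero => simp
    | add x y _ _ hx hy => rw [add_mul]; exact add_mem hx hy
    | neg x _ hx => exact (neg_mul x _).symm ▸ neg_mem hx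
    | mem x hx =>
      rcases g with _ | w
      · change x * nElt p ∈ A
        rcases hx with ⟨k, rfl⟩ | ⟨v, rfl⟩
        · simpa only [pow_succ] using hn (k + 1)
        · rw [mul_comm, nElt_mul_tElt]
          exact ht _
      · change x * tElt p w ∈ A
        rcases hx with ⟨k, rfl⟩ | ⟨v, rfl⟩
        · simpa only [nElt_pow_mul_tElt] using ht _
        · rw [tElt_mul_tElt]
          exact sum_mem fun j _ => ht _
  rw [eq_top_iff]
  rintro x -
  obtain ⟨f, rfl⟩ := Ideal.Quotient.mk_surjective x
  induction f using MvPolynomial.induction_on with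
  | C a =>
    have h := zsmul_mem (hn 0) a
    simpa using h
  | add f g hf hg => rw [map_add]; exact add_mem hf hg
  | mul_X f g hf => rw [map_mul]; exact hmul g _ hf

/-- The value on the monomial `x^v` of the additive map `orbitLift : S → T`: constant exponent
vectors go to powers of `n`, and for each other orbit exactly one monomial is sent to `t_v`. -/
noncomputable def orbitLiftFun (v : ZMod p → ℕ) : TRing p :=
  open Classical in
  if ∀ i, v i = v 0 then nElt p ^ v 0 else if orbitRep p v = v then tElt p v else 0

/-- An additive map `S → T` which inverts `φ` modulo `t_0̄ - p`. -/
noncomputable def orbitLift : MvPolynomial (ZMod p) ℤ →ₗ[ℤ] TRing p :=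
  (MvPolynomial.basisMonomials (ZMod p) ℤ).constr ℤ fun v => orbitLiftFun p v

theorem orbitLift_expMonomial (v : ZMod p → ℕ) :
    orbitLift p (expMonomial p v) = orbitLiftFun p v := by
  have h := (MvPolynomial.basisMonomials (ZMod p) ℤ).constr_basis ℤ
    (fun v => orbitLiftFun p v) (Finsupp.equivFunOnFinite.symm v)
  rw [MvPolynomial.coe_basisMonomials] at h
  exact h

theorem prod_X_pow_eq_expMonomial (k : ℕ) :
    (∏ i : ZMod p, (MvPolynomial.X i : MvPolynomial (ZMod p) ℤ)) ^ k =
      expMonomial p fun _ => k := by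
  rw [expMonomial, MvPolynomial.monomial_eq, Finsupp.prod_fintype _ _ (by simp)]
  simp [Finset.prod_pow]

theorem orbitLift_orbitSum_const (k : ℕ) :
    orbitLift p (orbitSum p fun _ => k) = p * nElt p ^ k := by
  have h : ∀ j : ZMod p, shiftVec p j (fun _ => k) = fun _ => k := fun _ => rfl
  simp only [orbitSum, h, map_sum, orbitLift_expMonomial]
  simp [orbitLiftFun, ZMod.card]

theorem orbitLift_orbitSum_of_not_const [Fact p.Prime] {v : ZMod p → ℕ}
    (hv : ¬ ∀ i, v i = v 0) : orbitLift p (orbitSum p v) = tElt p v := by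
  classical
  obtain ⟨j₀, hj₀⟩ := exists_shiftVec_eq_orbitRep p v
  have hc : ∀ j, ¬ ∀ i, shiftVec p j v i = shiftVec p j v 0 := by
    intro j h
    refine hv fun i => ?_
    have h₁ := h (i + j)
    have h₂ := h j
    simp only [shiftVec, add_sub_cancel_right, sub_self] at h₁ h₂
    rw [h₁, h₂]
  rw [orbitSum, map_sum, Finset.sum_eq_single j₀]
  · rw [orbitLift_expMonomial, orbitLiftFun, if_neg (hc j₀), orbitRep_shiftVec, if_pos hj₀.symm,
      tElt_shiftVec]
  · intro j _ hj
    rw [orbitLift_expMonomial, orbitLiftFun, if_neg (hc j), orbitRep_shiftVec, if_neg]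
    rw [← hj₀]
    exact fun h => hj (shiftVec_injective_of_not_const hv h.symm)
  · simp

end Relations

theorem statement5 (p : ℕ) (hp : p.Prime) [NeZero p]
    (φ : TRing p →+* MvPolynomial (ZMod p) ℤ)
    (hφn : φ (nElt p) = ∏ i : ZMod p, MvPolynomial.X i)
    (hφt : ∀ v : ZMod p → ℕ, φ (tElt p v) = orbitSum p v) :
    RingHom.ker φ = Ideal.span {tElt p (0 : ZMod p → ℕ) - (p : TRing p)} := by
  have := Fact.mk hp
  set I := Ideal.span {tElt p (0 : ZMod p → ℕ) - (p : TRing p)} with hI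
  apply le_antisymm
  · have key : ∀ x, orbitLift p (φ x) - x ∈ I := by
      intro x
      have hx : x ∈ AddSubgroup.closure
          (Set.range (fun k : ℕ => nElt p ^ k) ∪ Set.range (tElt p)) := by
        rw [closure_nElt_pow_union_tElt]
        trivial
      induction hx using AddSubgroup.closure_induction with
      | zero => simp
      | add x y _ _ hx hy =>
        rw [map_add, map_add, add_sub_add_comm]
        exact add_mem hx hy
      | neg x _ hx =>
        rw [map_neg, map_neg, ← neg_sub', neg_mem_iff]
        exact hx
      | mem x hx =>
        rcases hx with ⟨k, rfl⟩ | ⟨v, rfl⟩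
        · simp [hφn, prod_X_pow_eq_expMonomial, orbitLift_expMonomial, orbitLiftFun]
        · rw [hφt]
          by_cases hv : ∀ i, v i = v 0
          · obtain ⟨k, rfl⟩ : ∃ k, v = fun _ => k := ⟨v 0, funext hv⟩
            have ht : tElt p (fun _ => k) = nElt p ^ k * tElt p 0 := by
              rw [nElt_pow_mul_tElt, zero_add]
            rw [orbitLift_orbitSum_const, sub_mem_comm_iff, ht, mul_comm (p : TRing p), ← mul_sub]
            exact I.mul_mem_left _ (Ideal.mem_span_singleton_self _)
          · rw [orbitLift_orbitSum_of_not_const p hv, sub_self]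
            exact zero_mem _
    intro x hx
    have h := key x
    rwa [(RingHom.mem_ker).mp hx, map_zero, zero_sub, neg_mem_iff] at h
  · rw [hI, Ideal.span_singleton_le_iff_mem, RingHom.mem_ker, map_sub, hφt, map_natCast]
    have h : ∀ j : ZMod p, shiftVec p j 0 = 0 := fun _ => rfl
    have h₀ : expMonomial p 0 = 1 := (prod_X_pow_eq_expMonomial p 0).symm.trans (pow_zero _)
    simp [orbitSum, h, h₀, ZMod.card]
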